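/- arXiv:2510.09518 — 10 statements merged into one kernel-verified Lean document; each statement's English description precedes it below -/
import Mathlib

section
/- For every κ ∈ ℝ, the function w satisfies, at every point (z,ν) ∈ ℂ × ℂ: (Ξw)(z,ν) = 0 and ∂_ν̄ w(z,ν) = 0; in particular, for each fixed z ∈ ℂ the map ν ↦ w(z,ν) is holomorphic on all of ℂ. -/
open Complex ComplexConjugate

noncomputable def Aκ (κ : ℝ) (z ν : ℂ) : ℂ :=
  Complex.exp ((κ : ℂ) * (z * conj z - (conj z) ^ 2 * ν ^ 2) / 2)

noncomputable def wκ (κ : ℝ) (z ν : ℂ) : ℂ :=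
  (z - conj z * ν ^ 2) * Aκ κ z ν

/-- Wirtinger derivative ∂_z. -/
noncomputable def dz (F : ℂ × ℂ → ℂ) (p : ℂ × ℂ) : ℂ :=
  (1 / 2) * (fderiv ℝ F p (1, 0) - Complex.I * fderiv ℝ F p (Complex.I, 0))

/-- Wirtinger derivative ∂_z̄. -/
noncomputable def dzbar (F : ℂ × ℂ → ℂ) (p : ℂ × ℂ) : ℂ :=
  (1 / 2) * (fderiv ℝ F p (1, 0) + Complex.I * fderiv ℝ F p (Complex.I, 0))

/-- Wirtinger derivative ∂_ν. -/
noncomputable def dnu (F : ℂ × ℂ → ℂ) (p : ℂ × ℂ) : ℂ :=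
  (1 / 2) * (fderiv ℝ F p (0, 1) - Complex.I * fderiv ℝ F p (0, Complex.I))

/-- Wirtinger derivative ∂_ν̄. -/
noncomputable def dnubar (F : ℂ × ℂ → ℂ) (p : ℂ × ℂ) : ℂ :=
  (1 / 2) * (fderiv ℝ F p (0, 1) + Complex.I * fderiv ℝ F p (0, Complex.I))

/-- The vector field Ξ acting on a function of (z, ν). -/
noncomputable def Xi (κ : ℝ) (F : ℂ × ℂ → ℂ) (p : ℂ × ℂ) : ℂ :=
  ((2 + (κ : ℂ) * p.1 * conj p.1) * p.2 ^ 2 - (κ : ℂ) * p.1 ^ 2) * dz F p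
    + (2 + (κ : ℂ) * p.1 * conj p.1 - (κ : ℂ) * p.2 ^ 2 * (conj p.1) ^ 2) * dzbar F p
    + (κ : ℂ) * (p.1 - p.2 ^ 2 * conj p.1) * (conj p.2 * dnubar F p - p.2 * dnu F p)

/-- The real Frechet derivative of w applied to a direction. -/
theorem wκ_fderiv_apply (κ : ℝ) (p v : ℂ × ℂ) :
    fderiv ℝ (fun q : ℂ × ℂ => wκ κ q.1 q.2) p v =
      ((v.1 - (conj v.1 * p.2 ^ 2 + conj p.1 * (2 * p.2 * v.2))) +
        (p.1 - conj p.1 * p.2 ^ 2) * ((κ : ℂ) / 2 * (v.1 * conj p.1 + p.1 * conj v.1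
          - (2 * conj p.1 * conj v.1 * p.2 ^ 2 + (conj p.1) ^ 2 * (2 * p.2 * v.2))))) *
        Aκ κ p.1 p.2 := by
  have h1 : HasFDerivAt (fun q : ℂ × ℂ => q.1) (ContinuousLinearMap.fst ℝ ℂ ℂ) p :=
    hasFDerivAt_fst
  have h2 : HasFDerivAt (fun q : ℂ × ℂ => q.2) (ContinuousLinearMap.snd ℝ ℂ ℂ) p :=
    hasFDerivAt_snd
  have hc : HasFDerivAt (fun q : ℂ × ℂ => conj q.1)
      ((Complex.conjCLE : ℂ →L[ℝ] ℂ).comp (ContinuousLinearMap.fst ℝ ℂ ℂ)) p :=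
    (Complex.conjCLE : ℂ →L[ℝ] ℂ).hasFDerivAt.comp p h1
  have hE := ((((h1.mul hc).sub ((hc.mul hc).mul (h2.mul h2))).const_mul ((κ : ℂ) / 2))).cexp
  have hw := (h1.sub (hc.mul (h2.mul h2))).mul hE
  have heq : (fun q : ℂ × ℂ => wκ κ q.1 q.2) = fun q : ℂ × ℂ =>
      (q.1 - conj q.1 * (q.2 * q.2)) * Complex.exp ((κ : ℂ) / 2 *
        (q.1 * conj q.1 - conj q.1 * conj q.1 * (q.2 * q.2))) := by
    funext q
    unfold wκ Aκ
    congr 1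
    · ring
    · congr 1
      ring
  have hA : Aκ κ p.1 p.2 = Complex.exp ((κ : ℂ) / 2 *
        (p.1 * conj p.1 - conj p.1 * conj p.1 * (p.2 * p.2))) := by
    unfold Aκ
    congr 1
    ring
  rw [heq, hA]
  refine (congrArg (fun L : ℂ × ℂ →L[ℝ] ℂ => L v) hw.fderiv).trans ?_
  simp
  ring

/-- w is annihilated by Ξ and ∂_ν̄ everywhere, and ν ↦ w(z,ν) is entire. -/
theorem w_holomorphic (κ : ℝ) :
    (∀ p : ℂ × ℂ, Xi κ (fun q => wκ κ q.1 q.2) p = 0 ∧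
      dnubar (fun q => wκ κ q.1 q.2) p = 0) ∧
    ∀ z : ℂ, Differentiable ℂ (fun ν => wκ κ z ν) := by
  refine ⟨fun p => ⟨?_, ?_⟩, fun z => ?_⟩
  · simp only [Xi, dz, dzbar, dnu, dnubar, wκ_fderiv_apply, map_one, map_zero, Complex.conj_I]
    ring_nf
    simp only [Complex.I_sq]
    ring
  · simp only [dnubar, wκ_fderiv_apply, map_zero]
    ring_nf
    simp only [Complex.I_sq]
    ring
  · unfold wκ Aκ
    fun_prop
end

section
/- For every κ ∈ ℝ, the function ξ satisfies, at every point (z,ν) ∈ ℂ × ℂ: (Ξξ)(z,ν) = 0 and ∂_ν̄ ξ(z,ν) = 0; in particular, for each fixed z ∈ ℂ the map ν ↦ ξ(z,ν) is holomorphic on all of ℂ. -/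
open Complex ComplexConjugate

noncomputable def ξκ (κ : ℝ) (z ν : ℂ) : ℂ :=
  ν * Aκ κ z ν

/-- The real Fréchet derivative of ξ, evaluated on a vector. -/
theorem fderiv_xi_apply (κ : ℝ) (p v : ℂ × ℂ) :
    fderiv ℝ (fun q : ℂ × ℂ => ξκ κ q.1 q.2) p v =
      Aκ κ p.1 p.2 * (v.2 + p.2 * ((κ : ℂ) / 2 * (v.1 * conj p.1 + p.1 * conj v.1
        - 2 * conj p.1 * conj v.1 * p.2 ^ 2 - 2 * (conj p.1) ^ 2 * p.2 * v.2))) := by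
  have h1 : HasFDerivAt (fun q : ℂ × ℂ => q.1) (ContinuousLinearMap.fst ℝ ℂ ℂ) p :=
    hasFDerivAt_fst
  have h2 : HasFDerivAt (fun q : ℂ × ℂ => q.2) (ContinuousLinearMap.snd ℝ ℂ ℂ) p :=
    hasFDerivAt_snd
  have h3 : HasFDerivAt (fun q : ℂ × ℂ => conj q.1)
      ((Complex.conjCLE : ℂ →L[ℝ] ℂ).comp (ContinuousLinearMap.fst ℝ ℂ ℂ)) p :=
    (Complex.conjCLE : ℂ →L[ℝ] ℂ).hasFDerivAt.comp p h1
  have hE := ((((h1.mul h3).sub ((h3.mul h3).mul (h2.mul h2))).const_mul ((κ : ℂ) / 2)).cexp)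
  have h := h2.mul hE
  have hf : (fun q : ℂ × ℂ => ξκ κ q.1 q.2) = fun q : ℂ × ℂ => q.2 * Complex.exp ((κ : ℂ) / 2 *
      (q.1 * conj q.1 - conj q.1 * conj q.1 * (q.2 * q.2))) := by
    funext q
    unfold ξκ Aκ
    congr 2
    ring
  have hA : Aκ κ p.1 p.2 = Complex.exp ((κ : ℂ) / 2 *
      (p.1 * conj p.1 - conj p.1 * conj p.1 * (p.2 * p.2))) := by
    unfold Aκ
    congr 1
    ring
  rw [hf, hA]
  refine (congrArg (fun L : ℂ × ℂ →L[ℝ] ℂ => L v) h.fderiv).trans ?_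
  simp
  ring

/-- ξ is annihilated by Ξ and ∂_ν̄ everywhere, and ν ↦ ξ(z,ν) is entire. -/
theorem xi_holomorphic (κ : ℝ) :
    (∀ p : ℂ × ℂ, Xi κ (fun q => ξκ κ q.1 q.2) p = 0 ∧
      dnubar (fun q => ξκ κ q.1 q.2) p = 0) ∧
    ∀ z : ℂ, Differentiable ℂ (fun ν => ξκ κ z ν) := by
  refine ⟨fun p => ⟨?_, ?_⟩, fun z => ?_⟩
  · unfold Xi dz dzbar dnu dnubar
    simp only [fderiv_xi_apply, map_one, map_zero, Complex.conj_I]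
    ring_nf
    simp only [Complex.I_sq]
    ring
  · unfold dnubar
    simp only [fderiv_xi_apply, map_zero]
    ring_nf
    simp only [Complex.I_sq]
    ring
  · unfold ξκ Aκ
    fun_prop
end

section
/- Let R > 0 and κ ∈ ℝ. If (θ,α) and (θ',α') are pairs of real numbers with α, α' ∈ [−π/2, π/2] such that w∂(θ,α) = w∂(θ',α') and ξ∂(θ,α) = ξ∂(θ',α'), then α = α' and e^{iθ} = e^{iθ'}. In other words, the map (θ,α) ↦ (w∂(θ,α), ξ∂(θ,α)) is injective on (ℝ/2πℤ) × [−π/2, π/2]. -/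
open Complex Real

/-- The component w of the blow-down map restricted to the boundary, in fan-beam
coordinates (θ, α). -/
noncomputable def wb (R κ : ℝ) (θ α : ℝ) : ℂ :=
  (R : ℂ) * Complex.exp (Complex.I * θ) * (1 - Complex.exp (2 * Complex.I * α)) *
    Complex.exp ((κ : ℂ) * (R : ℂ) ^ 2 * (1 - Complex.exp (2 * Complex.I * α)) / 2)

/-- The component ξ of the blow-down map restricted to the boundary, in fan-beam
coordinates (θ, α). -/
noncomputable def xib (R κ : ℝ) (θ α : ℝ) : ℂ :=
  -Complex.exp (Complex.I * ((θ : ℂ) + (α : ℂ))) *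
    Complex.exp ((κ : ℂ) * (R : ℂ) ^ 2 * (1 - Complex.exp (2 * Complex.I * α)) / 2)

lemma wb_eq_xib (R κ θ α : ℝ) :
    wb R κ θ α = xib R κ θ α * (2 * Complex.I * R * (Real.sin α : ℂ)) := by
  have h1 : Complex.exp (2 * Complex.I * α) = Complex.exp (α * Complex.I) ^ 2 := by
    rw [← Complex.exp_nat_mul]; congr 1; push_cast; ring
  have h2 : Complex.exp (Complex.I * ((θ : ℂ) + (α : ℂ)))
      = Complex.exp (Complex.I * θ) * Complex.exp (α * Complex.I) := by
    rw [← Complex.exp_add]; congr 1; ring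
  have h3 : Complex.exp (α * Complex.I) * Complex.exp (-α * Complex.I) = 1 := by
    rw [← Complex.exp_add]; simp
  unfold wb xib
  rw [Complex.ofReal_sin, Complex.sin, h1, h2]
  generalize Complex.exp ((κ : ℂ) * (R : ℂ) ^ 2 * (1 - Complex.exp (α * Complex.I) ^ 2) / 2) = E
  generalize Complex.exp (α * Complex.I) = a at *
  generalize Complex.exp (-α * Complex.I) = b at *
  generalize Complex.exp (Complex.I * θ) = e
  linear_combination (-R * e * E) * h3 + R * e * E * a * (b - a) * Complex.I_sq

/-- injectivity of (w∂, ξ∂) on (ℝ/2πℤ) × [-π/2, π/2]. -/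
theorem boundary_injective (R κ : ℝ) (hR : 0 < R) (θ α θ' α' : ℝ)
    (hα : α ∈ Set.Icc (-(π / 2)) (π / 2)) (hα' : α' ∈ Set.Icc (-(π / 2)) (π / 2))
    (hw : wb R κ θ α = wb R κ θ' α') (hξ : xib R κ θ α = xib R κ θ' α') :
    α = α' ∧ Complex.exp (Complex.I * θ) = Complex.exp (Complex.I * θ') := by
  have hne : xib R κ θ' α' ≠ 0 := by
    unfold xib
    exact mul_ne_zero (neg_ne_zero.mpr (Complex.exp_ne_zero _)) (Complex.exp_ne_zero _)
  rw [wb_eq_xib, wb_eq_xib, hξ] at hw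
  have h := mul_left_cancel₀ hne hw
  have hc : (2 * Complex.I * R : ℂ) ≠ 0 := by
    simp [hR.ne']
  have hs : Real.sin α = Real.sin α' := by
    exact_mod_cast mul_left_cancel₀ hc h
  have hαα : α = α' := Real.injOn_sin hα hα' hs
  refine ⟨hαα, ?_⟩
  subst hαα
  unfold xib at hξ
  have h4 := neg_injective (mul_right_cancel₀ (Complex.exp_ne_zero _) hξ)
  rw [mul_add, mul_add, Complex.exp_add, Complex.exp_add] at h4
  exact mul_right_cancel₀ (Complex.exp_ne_zero _) h4
end

section
/- Let R > 0 and κ ∈ ℝ. For every α ∈ (−π/2, 0), the improper integral ∫_{−R sin α}^{R} (1+κr²)/(r·√(r² − R²sin²α)) dr converges and satisfies: −R sin α · ∫_{−R sin α}^{R} (1+κr²)/(r·√(r² − R²sin²α)) dr − π/2 = α − (κR²/2)·sin(2α). (This computes the scattering function 𝔰(α) = α − (κR²/2) sin(2α) of the disk of radius R with metric (1+κr²)²dr² + r²dθ².) -/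
open Real MeasureTheory

lemma aux_s {a r : ℝ} (ha : 0 < a) (hr : a < r) :
    HasDerivAt (fun r => Real.sqrt (r ^ 2 - a ^ 2)) (r ^ 2 / (r * Real.sqrt (r ^ 2 - a ^ 2))) r := by
  have hp : 0 < r ^ 2 - a ^ 2 := by nlinarith
  have hs : 0 < Real.sqrt (r ^ 2 - a ^ 2) := Real.sqrt_pos.mpr hp
  have h1 : HasDerivAt (fun r : ℝ => r ^ 2 - a ^ 2) (2 * r) r := by
    simpa using (hasDerivAt_pow 2 r).sub_const (a ^ 2)
  have h := h1.sqrt hp.ne'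
  have hr0 : r ≠ 0 := by linarith
  convert h using 1
  field_simp

lemma aux_t {a r : ℝ} (ha : 0 < a) (hr : a < r) :
    HasDerivAt (fun r => Real.arctan (Real.sqrt (r ^ 2 - a ^ 2) / a) / a)
      (1 / (r * Real.sqrt (r ^ 2 - a ^ 2))) r := by
  have hp : 0 < r ^ 2 - a ^ 2 := by nlinarith
  have hs : 0 < Real.sqrt (r ^ 2 - a ^ 2) := Real.sqrt_pos.mpr hp
  have hr0 : 0 < r := by linarith
  have h := (((aux_s ha hr).div_const a).arctan).div_const a
  have hq : 1 + (Real.sqrt (r ^ 2 - a ^ 2) / a) ^ 2 = r ^ 2 / a ^ 2 := by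
    rw [div_pow, Real.sq_sqrt hp.le]; field_simp; ring
  rw [hq] at h
  refine HasDerivAt.congr_deriv h ?_
  field_simp

/-- convergence and value of the scattering-function integral:
`𝔰(α) = α - (κR²/2) sin(2α)` for the metric `(1+κr²)² dr² + r² dθ²`. -/
theorem scattering_function (R κ α : ℝ) (hR : 0 < R)
    (hα : α ∈ Set.Ioo (-(π / 2)) 0) :
    IntervalIntegrable
      (fun r => (1 + κ * r ^ 2) / (r * Real.sqrt (r ^ 2 - R ^ 2 * Real.sin α ^ 2)))
      volume (-R * Real.sin α) R ∧
    (-R * Real.sin α) *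
        (∫ r in (-R * Real.sin α)..R,
          (1 + κ * r ^ 2) / (r * Real.sqrt (r ^ 2 - R ^ 2 * Real.sin α ^ 2)))
        - π / 2
      = α - κ * R ^ 2 / 2 * Real.sin (2 * α) := by
  obtain ⟨h1, h2⟩ := hα
  have hsin : Real.sin α < 0 := Real.sin_neg_of_neg_of_neg_pi_lt h2 (by linarith [Real.pi_pos])
  have hcos : 0 < Real.cos α := Real.cos_pos_of_mem_Ioo ⟨h1, by linarith [Real.pi_pos]⟩
  have hsc := Real.sin_sq_add_cos_sq α
  obtain ⟨a, haR⟩ : ∃ a, a = -R * Real.sin α := ⟨_, rfl⟩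
  have ha2 : R ^ 2 * Real.sin α ^ 2 = a ^ 2 := by rw [haR]; ring
  have ha : 0 < a := by rw [haR]; nlinarith
  have haleR : a < R := by
    have : -1 < Real.sin α := by nlinarith
    rw [haR]; nlinarith
  rw [← haR]
  simp only [ha2]
  have hsR : Real.sqrt (R ^ 2 - a ^ 2) = R * Real.cos α := by
    rw [Real.sqrt_eq_iff_mul_self_eq_of_pos (by positivity), haR]
    linear_combination R ^ 2 * hsc
  have heq : (fun r => (1 + κ * r ^ 2) / (r * Real.sqrt (r ^ 2 - a ^ 2))) =
      fun r => 1 / (r * Real.sqrt (r ^ 2 - a ^ 2)) + κ * (r ^ 2 / (r * Real.sqrt (r ^ 2 - a ^ 2))) := by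
    funext r; ring
  have i1 : IntervalIntegrable (fun r => 1 / (r * Real.sqrt (r ^ 2 - a ^ 2))) volume a R := by
    apply intervalIntegral.intervalIntegrable_deriv_of_nonneg
      (g := fun r => Real.arctan (Real.sqrt (r ^ 2 - a ^ 2) / a) / a)
    · exact Continuous.continuousOn (by fun_prop)
    · intro x hx
      rw [min_eq_left haleR.le] at hx
      exact aux_t ha hx.1
    · intro x hx
      rw [min_eq_left haleR.le] at hx
      have : 0 < x := ha.trans hx.1
      positivity
  have i2 : IntervalIntegrable (fun r => r ^ 2 / (r * Real.sqrt (r ^ 2 - a ^ 2))) volume a R := by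
    apply intervalIntegral.intervalIntegrable_deriv_of_nonneg
      (g := fun r => Real.sqrt (r ^ 2 - a ^ 2))
    · exact Continuous.continuousOn (by fun_prop)
    · intro x hx
      rw [min_eq_left haleR.le] at hx
      exact aux_s ha hx.1
    · intro x hx
      rw [min_eq_left haleR.le] at hx
      have : 0 < x := ha.trans hx.1
      positivity
  have hint := i1.add (i2.const_mul κ)
  rw [heq]
  refine ⟨hint, ?_⟩
  have e := intervalIntegral.integral_eq_sub_of_hasDerivAt_of_le haleR.le
    (f := fun r => Real.arctan (Real.sqrt (r ^ 2 - a ^ 2) / a) / a + κ * Real.sqrt (r ^ 2 - a ^ 2))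
    (Continuous.continuousOn (by fun_prop))
    (fun x hx => (aux_t ha hx.1).add ((aux_s ha hx.1).const_mul κ)) hint
  rw [e]
  have hat : Real.arctan (R * Real.cos α / a) = π / 2 + α := by
    apply Real.arctan_eq_of_tan_eq
    · rw [Real.tan_eq_sin_div_cos, add_comm, Real.sin_add_pi_div_two, Real.cos_add_pi_div_two, haR]
      have : -Real.sin α ≠ 0 := by linarith
      field_simp
    · constructor <;> linarith [Real.pi_pos]
  simp only [hsR, hat, sub_self, Real.sqrt_zero, zero_div, Real.arctan_zero, mul_zero, add_zero, sub_zero]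
  rw [mul_add, mul_div_cancel₀ _ ha.ne', Real.sin_two_mul, haR]
  ring
end

section
/- Let R > 0, κ ∈ ℝ, and ρ ∈ (0, R). Then the improper integral ∫_ρ^R (1+κr²)/(r·√(r² − ρ²)) dr converges and equals (1/ρ)·arctan(√(R² − ρ²)/ρ) + κ·√(R² − ρ²). -/
open Real MeasureTheory

/-- convergence and value of the integral
`∫_ρ^R (1+κr²)/(r √(r²-ρ²)) dr = (1/ρ) arctan(√(R²-ρ²)/ρ) + κ √(R²-ρ²)`. -/
theorem scattering_integral (R κ ρ : ℝ) (hR : 0 < R) (hρ : ρ ∈ Set.Ioo 0 R) :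
    IntervalIntegrable
      (fun r => (1 + κ * r ^ 2) / (r * Real.sqrt (r ^ 2 - ρ ^ 2))) volume ρ R ∧
    (∫ r in ρ..R, (1 + κ * r ^ 2) / (r * Real.sqrt (r ^ 2 - ρ ^ 2)))
      = (1 / ρ) * Real.arctan (Real.sqrt (R ^ 2 - ρ ^ 2) / ρ)
        + κ * Real.sqrt (R ^ 2 - ρ ^ 2) := by
  obtain ⟨h0, h1⟩ := hρ
  have hfun : (fun r : ℝ => (1 + κ * r ^ 2) / (r * Real.sqrt (r ^ 2 - ρ ^ 2)))
      = fun r => 1 / (r * Real.sqrt (r ^ 2 - ρ ^ 2)) + κ * (r / Real.sqrt (r ^ 2 - ρ ^ 2)) := by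
    funext r
    by_cases hr : r = 0
    · simp [hr]
    by_cases hs : Real.sqrt (r ^ 2 - ρ ^ 2) = 0
    · simp [hs]
    field_simp
  have hB : ∀ x ∈ Set.Ioo ρ R, HasDerivAt (fun r : ℝ => Real.sqrt (r ^ 2 - ρ ^ 2))
      (x / Real.sqrt (x ^ 2 - ρ ^ 2)) x := by
    intro x hx
    have hp : 0 < x ^ 2 - ρ ^ 2 := by nlinarith [hx.1]
    have h := ((hasDerivAt_pow 2 x).sub_const (ρ ^ 2)).sqrt hp.ne'
    have hs := Real.sqrt_pos.2 hp
    refine h.congr_deriv ?_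
    push_cast
    field_simp
  have hA : ∀ x ∈ Set.Ioo ρ R,
      HasDerivAt (fun r : ℝ => (1 / ρ) * Real.arctan (Real.sqrt (r ^ 2 - ρ ^ 2) / ρ))
      (1 / (x * Real.sqrt (x ^ 2 - ρ ^ 2))) x := by
    intro x hx
    have hp : 0 < x ^ 2 - ρ ^ 2 := by nlinarith [hx.1]
    have hx0 : 0 < x := h0.trans hx.1
    have hs := Real.sqrt_pos.2 hp
    have h := (((hB x hx).div_const ρ).arctan).const_mul (1 / ρ)
    refine h.congr_deriv ?_
    have e : 1 + (Real.sqrt (x ^ 2 - ρ ^ 2) / ρ) ^ 2 = x ^ 2 / ρ ^ 2 := by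
      rw [div_pow, Real.sq_sqrt hp.le]
      field_simp
      ring
    rw [e]
    field_simp
  have cB : Continuous (fun r : ℝ => Real.sqrt (r ^ 2 - ρ ^ 2)) := by fun_prop
  have cA : Continuous (fun r : ℝ => (1 / ρ) * Real.arctan (Real.sqrt (r ^ 2 - ρ ^ 2) / ρ)) :=
    continuous_const.mul (Real.continuous_arctan.comp (cB.div_const ρ))
  have iB : IntervalIntegrable (fun x : ℝ => x / Real.sqrt (x ^ 2 - ρ ^ 2)) volume ρ R := by
    refine intervalIntegral.intervalIntegrable_deriv_of_nonneg cB.continuousOn ?_ ?_ <;>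
      rw [min_eq_left h1.le, max_eq_right h1.le]
    · exact hB
    · intro x hx
      exact div_nonneg (h0.trans hx.1).le (Real.sqrt_nonneg _)
  have iA : IntervalIntegrable (fun x : ℝ => 1 / (x * Real.sqrt (x ^ 2 - ρ ^ 2))) volume ρ R := by
    refine intervalIntegral.intervalIntegrable_deriv_of_nonneg cA.continuousOn ?_ ?_ <;>
      rw [min_eq_left h1.le, max_eq_right h1.le]
    · exact hA
    · intro x hx
      exact div_nonneg zero_le_one (mul_nonneg (h0.trans hx.1).le (Real.sqrt_nonneg _))
  have iF := iA.add (iB.const_mul κ)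
  rw [hfun]
  refine ⟨iF, ?_⟩
  rw [intervalIntegral.integral_add iA (iB.const_mul κ), intervalIntegral.integral_const_mul,
    intervalIntegral.integral_eq_sub_of_hasDerivAt_of_le h1.le cA.continuousOn hA iA,
    intervalIntegral.integral_eq_sub_of_hasDerivAt_of_le h1.le cB.continuousOn hB iB]
  simp
end

section
/- For every κ ∈ ℝ and c ∈ ℂ, the set S = {u ∈ [0,1) : g_c(u) > 0} is an initial segment of [0,1) (i.e., if u ∈ S and 0 ≤ u' ≤ u then u' ∈ S), it contains 0, and h_c is strictly increasing on S; in particular h_c restricted to S is injective, so the equation h_c(u) = t has at most one solution u with g_c(u) > 0. -/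
open Real

/-- The function h_c. -/
noncomputable def hc (κ : ℝ) (c : ℂ) (u : ℝ) : ℝ :=
  u * Real.exp (κ * u * (c.re ^ 2 / (1 - u) + c.im ^ 2 / (1 + u)))

/-- The function g_c. -/
noncomputable def gc (κ : ℝ) (c : ℂ) (u : ℝ) : ℝ :=
  1 + κ * u * (c.re ^ 2 / (1 - u) ^ 2 + c.im ^ 2 / (1 + u) ^ 2)

lemma gc_aux_mono (A B u v : ℝ) (hA : 0 ≤ A) (hB : 0 ≤ B) (h0 : 0 ≤ v) (hvu : v ≤ u)
    (h1 : u < 1) :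
    v * (A / (1 - v) ^ 2 + B / (1 + v) ^ 2) ≤ u * (A / (1 - u) ^ 2 + B / (1 + u) ^ 2) := by
  have hu : 0 < 1 - u := by linarith
  have hv : 0 < 1 - v := by linarith
  have e1 : v / (1 - v) ^ 2 ≤ u / (1 - u) ^ 2 := by
    have : 0 ≤ u := h0.trans hvu
    gcongr
  have e2 : v / (1 + v) ^ 2 ≤ u / (1 + u) ^ 2 := by
    have h3 : 0 < 1 + v := by linarith
    have h4 : 0 < 1 + u := by linarith
    rw [div_le_div_iff₀ (by positivity) (by positivity)]
    have : 0 ≤ (u - v) * (1 - u * v) :=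
      mul_nonneg (by linarith) (by nlinarith)
    nlinarith
  have e3 := mul_le_mul_of_nonneg_left e1 hA
  have e4 := mul_le_mul_of_nonneg_left e2 hB
  calc _ = A * (v / (1 - v) ^ 2) + B * (v / (1 + v) ^ 2) := by ring
    _ ≤ A * (u / (1 - u) ^ 2) + B * (u / (1 + u) ^ 2) := by linarith
    _ = _ := by ring

lemma gc_aux_nonneg (A B u : ℝ) (hA : 0 ≤ A) (hB : 0 ≤ B) (h0 : 0 ≤ u) :
    0 ≤ u * (A / (1 - u) ^ 2 + B / (1 + u) ^ 2) := by positivity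

lemma gc_initial (κ : ℝ) (c : ℂ) (u v : ℝ) (h0 : 0 ≤ v) (hvu : v ≤ u) (h1 : u < 1)
    (hg : 0 < gc κ c u) : 0 < gc κ c v := by
  unfold gc at *
  rw [mul_assoc] at *
  have h2 := gc_aux_mono (c.re ^ 2) (c.im ^ 2) u v (sq_nonneg _) (sq_nonneg _) h0 hvu h1
  have h3 := gc_aux_nonneg (c.re ^ 2) (c.im ^ 2) v (sq_nonneg _) (sq_nonneg _) h0
  rcases le_total 0 κ with hk | hk
  · have := mul_nonneg hk h3
    linarith
  · have := mul_le_mul_of_nonpos_left h2 hk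
    linarith

lemma hc_hasDerivAt (κ : ℝ) (c : ℂ) (u : ℝ) (h0 : 0 ≤ u) (h1 : u < 1) :
    HasDerivAt (hc κ c)
      (Real.exp (κ * u * (c.re ^ 2 / (1 - u) + c.im ^ 2 / (1 + u))) * gc κ c u) u := by
  have hu : 1 - u ≠ 0 := by linarith
  have hv : 1 + u ≠ 0 := by linarith
  have d1 := (hasDerivAt_const u (c.re ^ 2)).div ((hasDerivAt_id' u).const_sub 1) hu
  have d2 := (hasDerivAt_const u (c.im ^ 2)).div ((hasDerivAt_id' u).const_add 1) hv
  have d := (hasDerivAt_id' u).mul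
    ((((hasDerivAt_id' u).const_mul κ).mul (d1.add d2)).exp)
  refine d.congr_deriv ?_
  simp only [gc, Pi.add_apply, Pi.mul_apply, Pi.div_apply]
  generalize Real.exp _ = E
  field_simp
  ring

/-- the set S = {u ∈ [0,1) : g_c(u) > 0} is an initial segment of
[0,1) containing 0, h_c is strictly increasing on S (hence injective there), so
h_c(u) = t has at most one solution u with g_c(u) > 0. -/
theorem hc_injective_on_positive_set (κ : ℝ) (c : ℂ) :
    (∀ u ∈ {u ∈ Set.Ico (0 : ℝ) 1 | gc κ c u > 0}, ∀ u' : ℝ, 0 ≤ u' → u' ≤ u →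
      u' ∈ {u ∈ Set.Ico (0 : ℝ) 1 | gc κ c u > 0}) ∧
    (0 : ℝ) ∈ {u ∈ Set.Ico (0 : ℝ) 1 | gc κ c u > 0} ∧
    StrictMonoOn (hc κ c) {u ∈ Set.Ico (0 : ℝ) 1 | gc κ c u > 0} ∧
    ∀ t : ℝ, ∀ u ∈ {u ∈ Set.Ico (0 : ℝ) 1 | gc κ c u > 0},
      ∀ u' ∈ {u ∈ Set.Ico (0 : ℝ) 1 | gc κ c u > 0},
        hc κ c u = t → hc κ c u' = t → u = u' := by
  have hini : ∀ u ∈ {u ∈ Set.Ico (0 : ℝ) 1 | gc κ c u > 0}, ∀ u' : ℝ, 0 ≤ u' → u' ≤ u →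
      u' ∈ {u ∈ Set.Ico (0 : ℝ) 1 | gc κ c u > 0} := by
    rintro u ⟨⟨_, h1⟩, hg⟩ v hv hvu
    exact ⟨⟨hv, hvu.trans_lt h1⟩, gc_initial κ c u v hv hvu h1 hg⟩
  have hmono : StrictMonoOn (hc κ c) {u ∈ Set.Ico (0 : ℝ) 1 | gc κ c u > 0} := by
    apply strictMonoOn_of_deriv_pos
    · apply Set.OrdConnected.convex
      exact ⟨fun x hx y hy z hz => hini y hy z (hx.1.1.trans hz.1) hz.2⟩
    · intro x hx
      exact (hc_hasDerivAt κ c x hx.1.1 hx.1.2).continuousAt.continuousWithinAt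
    · intro x hx
      have hx := interior_subset hx
      rw [(hc_hasDerivAt κ c x hx.1.1 hx.1.2).deriv]
      exact mul_pos (Real.exp_pos _) hx.2
  refine ⟨hini, ⟨by simp, by simp [gc]⟩, hmono, ?_⟩
  intro t u hu u' hu' h h'
  exact hmono.injOn hu hu' (h.trans h'.symm)
end

section
/- Let κ ∈ ℝ. For all r > 0 with 1 + κr² ≠ 0 and all θ, α ∈ ℝ, the function u(r,θ,α) = r·e^{iθ}·(1 − e^{2iα})·exp(κr²(1 − e^{2iα})/2) satisfies the transport equation (cos α/(1+κr²))·∂u/∂r + (sin α/r)·∂u/∂θ − (sin α/(r(1+κr²)))·∂u/∂α = 0, where the partial derivatives are the derivatives of u in each real variable separately. -/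
open Complex Real

/-- The restriction w|_{SM} in polar/angle coordinates (r, θ, α). -/
noncomputable def uSM (κ : ℝ) (r θ α : ℝ) : ℂ :=
  (r : ℂ) * Complex.exp (Complex.I * θ) * (1 - Complex.exp (2 * Complex.I * α)) *
    Complex.exp ((κ : ℂ) * (r : ℂ) ^ 2 * (1 - Complex.exp (2 * Complex.I * α)) / 2)

/-- w|_{SM} satisfies the transport equation Xu = 0 for the geodesic
vector field of the metric (1+κr²)² dr² + r² dθ². -/
theorem transport_w (κ : ℝ) (r θ α : ℝ) (hr : 0 < r) (hκr : 1 + κ * r ^ 2 ≠ 0) :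
    ((Real.cos α : ℂ) / (1 + (κ : ℂ) * (r : ℂ) ^ 2)) * deriv (fun s => uSM κ s θ α) r
      + ((Real.sin α : ℂ) / (r : ℂ)) * deriv (fun t => uSM κ r t α) θ
      - ((Real.sin α : ℂ) / ((r : ℂ) * (1 + (κ : ℂ) * (r : ℂ) ^ 2)))
          * deriv (fun b => uSM κ r θ b) α = 0 := by
  have hr' : (r : ℂ) ≠ 0 := by exact_mod_cast hr.ne'
  have hk : (1 + (κ : ℂ) * (r : ℂ) ^ 2) ≠ 0 := by exact_mod_cast hκr
  have hofR : ∀ x : ℝ, HasDerivAt (fun y : ℝ => (y : ℂ)) 1 x := fun x =>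
    (hasDerivAt_id x).ofReal_comp
  have hE : Complex.exp (2 * Complex.I * α)
      = ((Real.cos α : ℂ) + (Real.sin α : ℂ) * Complex.I) ^ 2 := by
    rw [Complex.ofReal_cos, Complex.ofReal_sin, ← Complex.exp_mul_I, ← Complex.exp_nat_mul]
    congr 1
    push_cast
    ring
  have hcs : (Real.cos α : ℂ) ^ 2 + (Real.sin α : ℂ) ^ 2 = 1 := by
    exact_mod_cast Real.cos_sq_add_sin_sq α
  have hI : Complex.I ^ 2 = -1 := Complex.I_sq
  have h1 := (((hofR r).mul_const (Complex.exp (Complex.I * θ))).mul_const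
    (1 - Complex.exp (2 * Complex.I * α))).mul
    ((((((hofR r).pow 2).const_mul (κ : ℂ)).mul_const
      (1 - Complex.exp (2 * Complex.I * α))).div_const 2).cexp)
  have h2 := (((((hofR θ).const_mul Complex.I).cexp).const_mul (r : ℂ)).mul_const
    (1 - Complex.exp (2 * Complex.I * α))).mul_const
    (Complex.exp ((κ : ℂ) * (r : ℂ) ^ 2 * (1 - Complex.exp (2 * Complex.I * α)) / 2))
  have hq := (((hofR α).const_mul (2 * Complex.I)).cexp).const_sub 1
  have h3 := (hq.const_mul ((r : ℂ) * Complex.exp (Complex.I * θ))).mul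
    (((hq.const_mul ((κ : ℂ) * (r : ℂ) ^ 2)).div_const 2).cexp)
  have e1 : deriv (fun s => uSM κ s θ α) r = _ := h1.deriv
  have e2 : deriv (fun t => uSM κ r t α) θ = _ := h2.deriv
  have e3 : deriv (fun b => uSM κ r θ b) α = _ := h3.deriv
  rw [e1, e2, e3]
  simp only [Pi.pow_apply]
  generalize Complex.exp ((κ : ℂ) * (r : ℂ) ^ 2 * (1 - Complex.exp (2 * Complex.I * α)) / 2) = G
  rw [hE]
  generalize Complex.exp (Complex.I * θ) = T
  generalize (Real.cos α : ℂ) = c at *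
  generalize (Real.sin α : ℂ) = s at *
  generalize Complex.I = J at *
  field_simp
  clear h1 h2 h3 hq e1 e2 e3 hE
  push_cast
  grind
end

section
/- Let κ ∈ ℝ. For all r > 0 with 1 + κr² ≠ 0 and all θ, α ∈ ℝ, the function v(r,θ,α) = e^{i(θ+α)}·exp(κr²(1 − e^{2iα})/2) satisfies the transport equation (cos α/(1+κr²))·∂v/∂r + (sin α/r)·∂v/∂θ − (sin α/(r(1+κr²)))·∂v/∂α = 0, where the partial derivatives are the derivatives of v in each real variable separately. -/
open Complex Real

/-- The restriction ξ|_{SM} in polar/angle coordinates (r, θ, α). -/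
noncomputable def vSM (κ : ℝ) (r θ α : ℝ) : ℂ :=
  Complex.exp (Complex.I * ((θ : ℂ) + (α : ℂ))) *
    Complex.exp ((κ : ℂ) * (r : ℂ) ^ 2 * (1 - Complex.exp (2 * Complex.I * α)) / 2)

/-- ξ|_{SM} satisfies the transport equation Xv = 0 for the geodesic
vector field of the metric (1+κr²)² dr² + r² dθ². -/
theorem transport_xi (κ : ℝ) (r θ α : ℝ) (hr : 0 < r) (hκr : 1 + κ * r ^ 2 ≠ 0) :
    ((Real.cos α : ℂ) / (1 + (κ : ℂ) * (r : ℂ) ^ 2)) * deriv (fun s => vSM κ s θ α) r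
      + ((Real.sin α : ℂ) / (r : ℂ)) * deriv (fun t => vSM κ r t α) θ
      - ((Real.sin α : ℂ) / ((r : ℂ) * (1 + (κ : ℂ) * (r : ℂ) ^ 2)))
          * deriv (fun b => vSM κ r θ b) α = 0 := by
  have hr' : (r : ℂ) ≠ 0 := by exact_mod_cast hr.ne'
  have hk : (1 + (κ : ℂ) * (r : ℂ) ^ 2) ≠ 0 := by exact_mod_cast hκr
  have hof : ∀ x : ℝ, HasDerivAt (fun y : ℝ => (y : ℂ)) 1 x := fun x =>
    Complex.ofRealCLM.hasDerivAt
  have h1 : HasDerivAt (fun s => vSM κ s θ α)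
      ((κ : ℂ) * r * (1 - Complex.exp (2 * Complex.I * α)) * vSM κ r θ α) r := by
    unfold vSM
    have := ((((((hof r).pow 2).const_mul (κ : ℂ)).mul_const
      (1 - Complex.exp (2 * Complex.I * α))).div_const 2).cexp).const_mul
      (Complex.exp (Complex.I * ((θ : ℂ) + (α : ℂ))))
    refine this.congr_deriv ?_
    simp only [Pi.pow_apply]
    push_cast
    ring
  have h2 : HasDerivAt (fun t => vSM κ r t α) (Complex.I * vSM κ r θ α) θ := by
    unfold vSM
    have := ((((hof θ).add_const (α : ℂ)).const_mul Complex.I).cexp).mul_const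
      (Complex.exp ((κ : ℂ) * (r : ℂ) ^ 2 * (1 - Complex.exp (2 * Complex.I * α)) / 2))
    refine this.congr_deriv ?_
    ring
  have h3 : HasDerivAt (fun b => vSM κ r θ b)
      (Complex.I * (1 - (κ : ℂ) * r ^ 2 * Complex.exp (2 * Complex.I * α)) * vSM κ r θ α) α := by
    unfold vSM
    have := ((((hof α).const_add (θ : ℂ)).const_mul Complex.I).cexp).mul
      ((((((hof α).const_mul (2 * Complex.I)).cexp).const_sub 1).const_mul
        ((κ : ℂ) * (r : ℂ) ^ 2)).div_const 2).cexp
    refine this.congr_deriv ?_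
    ring
  rw [h1.deriv, h2.deriv, h3.deriv]
  have hE : Complex.exp (2 * Complex.I * α)
      = ((Real.cos α : ℂ) + (Real.sin α : ℂ) * Complex.I) ^ 2 := by
    rw [Complex.ofReal_cos, Complex.ofReal_sin, ← Complex.exp_mul_I, ← Complex.exp_nat_mul]
    congr 1
    push_cast
    ring
  have hcs : (Real.cos α : ℂ) ^ 2 + (Real.sin α : ℂ) ^ 2 = 1 := by
    exact_mod_cast Real.cos_sq_add_sin_sq α
  rw [hE]
  generalize (Real.cos α : ℂ) = c at *
  generalize (Real.sin α : ℂ) = s at *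
  generalize vSM κ r θ α = v
  have key : c * (1 - (c + s * Complex.I) ^ 2) + Complex.I * s * (1 + (c + s * Complex.I) ^ 2)
      = 0 := by
    linear_combination (-(c + s * Complex.I)) * hcs
      + (s ^ 2 * (c + s * Complex.I)) * Complex.I_sq
  have hfin : c / (1 + (κ : ℂ) * r ^ 2) * ((κ : ℂ) * r * (1 - (c + s * Complex.I) ^ 2) * v)
      + s / r * (Complex.I * v)
      - s / (r * (1 + (κ : ℂ) * r ^ 2))
        * (Complex.I * (1 - (κ : ℂ) * r ^ 2 * (c + s * Complex.I) ^ 2) * v)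
      = (κ : ℂ) * r * v / (1 + (κ : ℂ) * r ^ 2)
        * (c * (1 - (c + s * Complex.I) ^ 2)
          + Complex.I * s * (1 + (c + s * Complex.I) ^ 2)) := by
    generalize (c + s * Complex.I) ^ 2 = E
    field_simp
    ring
  rw [hfin, key, mul_zero]
end

section
/- Let R > 0, κ ≥ 0, m ∈ ℕ, and let F : ℂ → ℂ be complex-differentiable on an open set containing the closed ball {ζ ∈ ℂ : |ζ| ≤ 2R·e^{κR²}}. Define f(r,θ,α) = v(r,θ,α)^m · F(u(r,θ,α)), where u(r,θ,α) = r·e^{iθ}·(1 − e^{2iα})·exp(κr²(1 − e^{2iα})/2) and v(r,θ,α) = e^{i(θ+α)}·exp(κr²(1 − e^{2iα})/2). Then for all r ∈ (0, R] and all θ, α ∈ ℝ: (cos α/(1+κr²))·∂f/∂r + (sin α/r)·∂f/∂θ − (sin α/(r(1+κr²)))·∂f/∂α = 0. -/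
open Complex Real

theorem uSM_norm_le (R κ : ℝ) (hκ : 0 ≤ κ) (r θ α : ℝ) (hr : r ∈ Set.Ioc (0 : ℝ) R) :
    ‖uSM κ r θ α‖ ≤ 2 * R * Real.exp (κ * R ^ 2) := by
  obtain ⟨h0, h1⟩ := hr
  have e1 : ‖Complex.exp (Complex.I * θ)‖ = 1 := by
    rw [mul_comm]; exact Complex.norm_exp_ofReal_mul_I θ
  have e2 : ‖Complex.exp (2 * Complex.I * α)‖ = 1 := by
    have : 2 * Complex.I * α = ((2 * α : ℝ) : ℂ) * Complex.I := by push_cast; ring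
    rw [this]; exact Complex.norm_exp_ofReal_mul_I _
  set E := Complex.exp (2 * Complex.I * α) with hE
  have e3 : ‖1 - E‖ ≤ 2 := by
    calc ‖1 - E‖ ≤ ‖(1 : ℂ)‖ + ‖E‖ := norm_sub_le _ _
      _ = 2 := by rw [e2]; norm_num
  have e4 : ((κ : ℂ) * (r : ℂ) ^ 2 * (1 - E) / 2).re ≤ κ * R ^ 2 := by
    have : (κ : ℂ) * (r : ℂ) ^ 2 * (1 - E) / 2 = ((κ * r ^ 2 / 2 : ℝ) : ℂ) * (1 - E) := by
      push_cast; ring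
    rw [this, Complex.re_ofReal_mul]
    have h5 : (1 - E).re ≤ 2 := (Complex.re_le_norm _).trans e3
    have h6 : κ * r ^ 2 ≤ κ * R ^ 2 := by gcongr
    have h7 : 0 ≤ κ * r ^ 2 / 2 := by positivity
    nlinarith [mul_le_mul_of_nonneg_left h5 h7]
  unfold uSM
  rw [← hE, norm_mul, norm_mul, norm_mul, e1, Complex.norm_exp, Complex.norm_real,
    Real.norm_of_nonneg h0.le]
  have e5 := Real.exp_le_exp.2 e4
  have e6 : r * 1 * ‖1 - E‖ ≤ 2 * R := by nlinarith [norm_nonneg (1 - E)]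
  exact mul_le_mul e6 e5 (Real.exp_pos _).le (by linarith)

theorem hasDerivAt_comp_SM (m : ℕ) (F : ℂ → ℂ) (v u : ℝ → ℂ) (dv du : ℂ) (x : ℝ)
    (hv : HasDerivAt v dv x) (hu : HasDerivAt u du x) (hF : DifferentiableAt ℂ F (u x)) :
    deriv (fun s => v s ^ m * F (u s)) x
      = (m * v x ^ (m - 1) * F (u x)) * dv + (v x ^ m * deriv F (u x)) * du := by
  have h1 := (hv.pow m).mul (hF.hasDerivAt.comp x hu)
  have h2 := h1.deriv
  refine Eq.trans ?_ (h2.trans ?_)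
  · rfl
  · simp only [Function.comp, Pi.pow_apply]
    ring

/-- for κ ≥ 0 and F holomorphic on a neighborhood of the closed
ball of radius 2R e^{κR²}, the function f = (ξ|_{SM})^m · F(w|_{SM}) is invariant
under the geodesic vector field. -/
theorem transport_invariant (R κ : ℝ) (hR : 0 < R) (hκ : 0 ≤ κ) (m : ℕ)
    (F : ℂ → ℂ) (U : Set ℂ) (hU : IsOpen U)
    (hball : Metric.closedBall (0 : ℂ) (2 * R * Real.exp (κ * R ^ 2)) ⊆ U)
    (hF : DifferentiableOn ℂ F U) :
    ∀ r ∈ Set.Ioc (0 : ℝ) R, ∀ θ α : ℝ,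
      ((Real.cos α : ℂ) / (1 + (κ : ℂ) * (r : ℂ) ^ 2))
          * deriv (fun s => vSM κ s θ α ^ m * F (uSM κ s θ α)) r
        + ((Real.sin α : ℂ) / (r : ℂ))
            * deriv (fun t => vSM κ r t α ^ m * F (uSM κ r t α)) θ
        - ((Real.sin α : ℂ) / ((r : ℂ) * (1 + (κ : ℂ) * (r : ℂ) ^ 2)))
            * deriv (fun b => vSM κ r θ b ^ m * F (uSM κ r θ b)) α = 0 := by
  intro r hr θ α
  have hFd : DifferentiableAt ℂ F (uSM κ r θ α) :=
    hF.differentiableAt (hU.mem_nhds (hball (by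
      simpa using uSM_norm_le R κ hκ r θ α hr)))
  have hr0 : (r : ℂ) ≠ 0 := by exact_mod_cast (ne_of_gt hr.1)
  have hp : (1 + (κ : ℂ) * (r : ℂ) ^ 2) ≠ 0 := by
    have : (1 + κ * r ^ 2) ≠ 0 := by positivity
    exact_mod_cast this
  set E := Complex.exp (2 * Complex.I * α) with hE
  set G := Complex.exp ((κ : ℂ) * (r : ℂ) ^ 2 * (1 - E) / 2) with hG
  set T := Complex.exp (Complex.I * θ) with hT
  set V := Complex.exp (Complex.I * ((θ : ℂ) + (α : ℂ))) with hV
  have dr : HasDerivAt (fun s : ℝ => (s : ℂ)) 1 r := Complex.ofRealCLM.hasDerivAt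
  have dθ : HasDerivAt (fun s : ℝ => (s : ℂ)) 1 θ := Complex.ofRealCLM.hasDerivAt
  have dα : HasDerivAt (fun s : ℝ => (s : ℂ)) 1 α := Complex.ofRealCLM.hasDerivAt
  -- derivatives of the exponential pieces
  have gr : HasDerivAt (fun s : ℝ => Complex.exp ((κ : ℂ) * (s : ℂ) ^ 2 * (1 - E) / 2))
      (G * ((κ : ℂ) * r * (1 - E))) r := by
    have := (((dr.fun_pow 2).const_mul (κ : ℂ)).mul_const (1 - E)).div_const 2 |>.cexp
    refine this.congr_deriv ?_
    rw [hG]; push_cast; ring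
  have eα : HasDerivAt (fun b : ℝ => Complex.exp (2 * Complex.I * b))
      (E * (2 * Complex.I)) α := by
    refine (dα.const_mul (2 * Complex.I)).cexp.congr_deriv ?_
    rw [hE]; ring
  have gα : HasDerivAt (fun b : ℝ => Complex.exp ((κ : ℂ) * (r : ℂ) ^ 2 *
      (1 - Complex.exp (2 * Complex.I * b)) / 2))
      (G * (-(Complex.I * κ * r ^ 2 * E))) α := by
    have := (((eα.const_sub 1).const_mul ((κ : ℂ) * (r : ℂ) ^ 2)).div_const 2).cexp
    refine this.congr_deriv ?_
    rw [hG]; ring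
  have tθ : HasDerivAt (fun t : ℝ => Complex.exp (Complex.I * t)) (T * Complex.I) θ := by
    refine (dθ.const_mul Complex.I).cexp.congr_deriv ?_
    rw [hT]; ring
  have vθ : HasDerivAt (fun t : ℝ => Complex.exp (Complex.I * ((t : ℂ) + (α : ℂ))))
      (V * Complex.I) θ := by
    refine ((dθ.add_const (α : ℂ)).const_mul Complex.I).cexp.congr_deriv ?_
    rw [hV]; ring
  have vα : HasDerivAt (fun b : ℝ => Complex.exp (Complex.I * ((θ : ℂ) + (b : ℂ))))
      (V * Complex.I) α := by
    refine ((dα.const_add (θ : ℂ)).const_mul Complex.I).cexp.congr_deriv ?_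
    rw [hV]; ring
  have Vr : HasDerivAt (fun s => vSM κ s θ α) (V * (G * ((κ : ℂ) * r * (1 - E)))) r :=
    gr.const_mul V
  have Vθ : HasDerivAt (fun t => vSM κ r t α) (V * Complex.I * G) θ := vθ.mul_const G
  have Vα : HasDerivAt (fun b => vSM κ r θ b)
      (V * Complex.I * G + V * (G * (-(Complex.I * κ * r ^ 2 * E)))) α := vα.mul gα
  have Ur : HasDerivAt (fun s => uSM κ s θ α)
      (1 * T * (1 - E) * G + r * T * (1 - E) * (G * ((κ : ℂ) * r * (1 - E)))) r :=
    ((dr.mul_const T).mul_const (1 - E)).mul gr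
  have Uθ : HasDerivAt (fun t => uSM κ r t α)
      (r * (T * Complex.I) * (1 - E) * G) θ :=
    ((tθ.const_mul (r : ℂ)).mul_const (1 - E)).mul_const G
  have Uα : HasDerivAt (fun b => uSM κ r θ b)
      (r * T * (-(E * (2 * Complex.I))) * G
        + r * T * (1 - E) * (G * (-(Complex.I * κ * r ^ 2 * E)))) α :=
    ((eα.const_sub 1).const_mul ((r : ℂ) * T)).mul gα
  rw [hasDerivAt_comp_SM m F _ _ _ _ r Vr Ur hFd, hasDerivAt_comp_SM m F _ _ _ _ θ Vθ Uθ hFd,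
    hasDerivAt_comp_SM m F _ _ _ _ α Vα Uα hFd]
  have key : (Real.cos α : ℂ) * (1 - E) + Complex.I * (Real.sin α : ℂ) * (1 + E) = 0 := by
    have hE2 : E = ((Real.cos α : ℂ) + (Real.sin α : ℂ) * Complex.I) ^ 2 := by
      rw [Complex.ofReal_cos, Complex.ofReal_sin, ← Complex.exp_mul_I, ← Complex.exp_nat_mul, hE]
      congr 1; push_cast; ring
    have hcs : (Real.cos α : ℂ) ^ 2 + (Real.sin α : ℂ) ^ 2 = 1 := by
      exact_mod_cast Real.cos_sq_add_sin_sq α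
    rw [hE2]
    generalize (Real.cos α : ℂ) = c at *
    generalize (Real.sin α : ℂ) = s at *
    have hI := Complex.I_sq
    generalize Complex.I = i at *
    linear_combination (-c - s * i) * hcs + (s ^ 3 * i + c * s ^ 2) * hI
  generalize (m : ℂ) * vSM κ r θ α ^ (m - 1) * F (uSM κ r θ α) = A
  generalize vSM κ r θ α ^ m * deriv F (uSM κ r θ α) = B
  generalize (Real.cos α : ℂ) = c at *
  generalize (Real.sin α : ℂ) = s at *
  clear_value E G T V
  field_simp
  linear_combination (A * V * G * κ * r ^ 2 + B * r * T * G * (1 + κ * r ^ 2 * (1 - E))) * key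
end

section
/- Let ã : ℝ → ℝ be infinitely differentiable, set a(x,y) = 1 + (x²+y²)·ã(x²+y²), and let U = {(x,y) ∈ ℝ² : a(x,y) > 0}. Define F : U → ℝ² by F(x,y) = (1, 0) − (ã(x²+y²)/a(x,y))·(x², x·y). Then F is infinitely differentiable on U, F(0,0) = (1,0), and for every (x,y) ∈ U with (x,y) ≠ (0,0), writing r = √(x²+y²), cos θ = x/r, sin θ = y/r, one has F(x,y) = cos θ·(1/a(x,y))·(cos θ, sin θ) − sin θ·(−sin θ, cos θ). (Hence the unit vector field 𝐞 = cos θ·𝐞_r − sin θ·𝐞_θ, a priori defined only away from the origin, extends smoothly across the origin.) -/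
open Real

/-- The conformal factor a(x,y) = 1 + (x²+y²)·ã(x²+y²). -/
noncomputable def aMet (atil : ℝ → ℝ) (p : ℝ × ℝ) : ℝ :=
  1 + (p.1 ^ 2 + p.2 ^ 2) * atil (p.1 ^ 2 + p.2 ^ 2)

/-- Cartesian expression of the vector field 𝐞 = cos θ 𝐞_r - sin θ 𝐞_θ. -/
noncomputable def eVF (atil : ℝ → ℝ) (p : ℝ × ℝ) : ℝ × ℝ :=
  ((1 : ℝ), 0) - (atil (p.1 ^ 2 + p.2 ^ 2) / aMet atil p) • (p.1 ^ 2, p.1 * p.2)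

/-- the vector field 𝐞 extends smoothly across the origin:
F is smooth on U = {a > 0}, F(0,0) = (1,0), and away from the origin F agrees with
cos θ · (1/a) · (cos θ, sin θ) - sin θ · (-sin θ, cos θ). -/
theorem e_extends_smoothly (atil : ℝ → ℝ) (hatil : ContDiff ℝ (⊤ : ℕ∞) atil) :
    ContDiffOn ℝ (⊤ : ℕ∞) (eVF atil) {p : ℝ × ℝ | 0 < aMet atil p} ∧
    eVF atil (0, 0) = (1, 0) ∧
    ∀ p ∈ {p : ℝ × ℝ | 0 < aMet atil p}, p ≠ (0, 0) →
      eVF atil p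
        = (p.1 / Real.sqrt (p.1 ^ 2 + p.2 ^ 2)) •
            ((1 / aMet atil p) •
              ((p.1 / Real.sqrt (p.1 ^ 2 + p.2 ^ 2),
                p.2 / Real.sqrt (p.1 ^ 2 + p.2 ^ 2)) : ℝ × ℝ))
          - (p.2 / Real.sqrt (p.1 ^ 2 + p.2 ^ 2)) •
              ((-(p.2 / Real.sqrt (p.1 ^ 2 + p.2 ^ 2)),
                p.1 / Real.sqrt (p.1 ^ 2 + p.2 ^ 2)) : ℝ × ℝ) := by
  have hq : ContDiff ℝ (⊤ : ℕ∞) (fun p : ℝ × ℝ => p.1 ^ 2 + p.2 ^ 2) := by fun_prop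
  have hA : ContDiff ℝ (⊤ : ℕ∞) (fun p : ℝ × ℝ => atil (p.1 ^ 2 + p.2 ^ 2)) := hatil.comp hq
  have ha : ContDiff ℝ (⊤ : ℕ∞) (aMet atil) := contDiff_const.add (hq.mul hA)
  have hv : ContDiff ℝ (⊤ : ℕ∞) (fun p : ℝ × ℝ => (p.1 ^ 2, p.1 * p.2)) := by fun_prop
  refine ⟨?_, ?_, ?_⟩
  · exact contDiffOn_const.sub
      ((hA.contDiffOn.div ha.contDiffOn (fun p hp => ne_of_gt hp)).smul hv.contDiffOn)
  · simp [eVF]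
  · rintro ⟨x, y⟩ hp h0
    have hpos : 0 < x ^ 2 + y ^ 2 := by
      by_contra h
      apply h0
      have hx : x = 0 := by nlinarith [sq_nonneg x, sq_nonneg y]
      have hy : y = 0 := by nlinarith [sq_nonneg x, sq_nonneg y]
      rw [hx, hy]
    have hr : 0 < Real.sqrt (x ^ 2 + y ^ 2) := Real.sqrt_pos.mpr hpos
    have hr2 : Real.sqrt (x ^ 2 + y ^ 2) ^ 2 = x ^ 2 + y ^ 2 := Real.sq_sqrt hpos.le
    have hadef : aMet atil (x, y) = 1 + (x ^ 2 + y ^ 2) * atil (x ^ 2 + y ^ 2) := rfl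
    have hap : 0 < aMet atil (x, y) := hp
    simp only [eVF]
    generalize aMet atil (x, y) = a at *
    generalize atil (x ^ 2 + y ^ 2) = t at *
    generalize Real.sqrt (x ^ 2 + y ^ 2) = r at *
    rw [← hr2] at hadef
    have hra := hr.ne'
    have haa := hap.ne'
    ext
    · simp only [Prod.fst_sub, Prod.smul_fst, smul_eq_mul]
      field_simp
      linear_combination (a) * hr2 + x ^ 2 * hadef
    · simp only [Prod.snd_sub, Prod.smul_snd, smul_eq_mul]
      field_simp
      linear_combination x * y * hadef
end
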